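/- (Definable Positivstellensatz, part (ii)) Let r be a nonnegative integer and f₁, …, f_k: ℝⁿ → ℝ definable C^r functions such that S = {x ∈ ℝⁿ : f_i(x) ≥ 0 for i = 1, …, k} is nonempty, and let g: ℝⁿ → ℝ be a definable C^r function with g > 0 on S. Then there exist definable C^r functions v₀, v₁, …, v_k: ℝⁿ → ℝ such that g = v₀² + Σ_{i=1}^{k} v_i²·f_i on ℝⁿ. -/

import Mathlib

open FirstOrder Set Topology

namespace Paper

variable (L : FirstOrder.Language) [L.Structure ℝ]

/-- A subset of `ℝⁿ` is definable in the structure (with parameters from `ℝ`). -/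
def Def (n : ℕ) (s : Set (Fin n → ℝ)) : Prop :=
  Set.Definable (Set.univ : Set ℝ) L s

/-- A subset of `ℝ` is definable. -/
def Def1 (s : Set ℝ) : Prop := Def L 1 {x | x 0 ∈ s}

/-- The structure expands the ordered field `(ℝ, <, +, ·, 0, 1)`:
the order and the field operations (and the constants) are definable. -/
def ExpandsOrderedField : Prop :=
  Def L 2 {x | x 0 < x 1} ∧ Def L 3 {x | x 0 + x 1 = x 2} ∧
  Def L 3 {x | x 0 * x 1 = x 2} ∧ Def L 1 {x | x 0 = 0} ∧ Def L 1 {x | x 0 = 1}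

/-- Local o-minimality: every definable subset of `ℝ` is, near each point, a finite
union of points and open intervals. -/
def LocallyOMinimal : Prop :=
  ∀ X : Set ℝ, Def1 L X → ∀ a : ℝ,
    ∃ b c : ℝ, b < a ∧ a < c ∧
      ∃ (P : Finset ℝ) (J : Finset (ℝ × ℝ)),
        X ∩ Set.Ioo b c = ↑P ∪ ⋃ p ∈ J, Set.Ioo p.1 p.2

/-- First component of a point of `ℝ^(m+n) = ℝ^m × ℝ^n`. -/
def fstFun {m n : ℕ} (z : Fin (m + n) → ℝ) : Fin m → ℝ := fun i => z (Fin.castAdd n i)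

/-- Second component of a point of `ℝ^(m+n) = ℝ^m × ℝ^n`. -/
def sndFun {m n : ℕ} (z : Fin (m + n) → ℝ) : Fin n → ℝ := fun j => z (Fin.natAdd m j)

/-- The map `f : X → ℝⁿ`, `X ⊆ ℝ^m`, is definable (its graph over `X` is definable). -/
def DefMapOn (m n : ℕ) (X : Set (Fin m → ℝ)) (f : (Fin m → ℝ) → (Fin n → ℝ)) : Prop :=
  Def L (m + n) {z | fstFun z ∈ X ∧ sndFun z = f (fstFun z)}

/-- The function `f : X → ℝ`, `X ⊆ ℝ^m`, is definable. -/
def DefFunOn (m : ℕ) (X : Set (Fin m → ℝ)) (f : (Fin m → ℝ) → ℝ) : Prop :=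
  DefMapOn L m 1 X fun x _ => f x

/-- `f` is of class `C^r` on `X` in the sense that near every point of `X` it agrees on `X`
with a `C^r` map defined on an open neighborhood in the ambient space. -/
def CrMapOn (r m n : ℕ) (X : Set (Fin m → ℝ)) (f : (Fin m → ℝ) → (Fin n → ℝ)) : Prop :=
  ∀ a ∈ X, ∃ (W : Set (Fin m → ℝ)) (g : (Fin m → ℝ) → (Fin n → ℝ)),
    a ∈ W ∧ IsOpen W ∧ ContDiffOn ℝ r g W ∧ Set.EqOn f g (X ∩ W)

/-- Real-valued version of `CrMapOn`. -/
def CrFunOn (r m : ℕ) (X : Set (Fin m → ℝ)) (f : (Fin m → ℝ) → ℝ) : Prop :=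
  ∀ a ∈ X, ∃ (W : Set (Fin m → ℝ)) (g : (Fin m → ℝ) → ℝ),
    a ∈ W ∧ IsOpen W ∧ ContDiffOn ℝ r g W ∧ Set.EqOn f g (X ∩ W)

/-- A definable `C^r` map `X → ℝⁿ`. -/
def DefCrMapOn (r m n : ℕ) (X : Set (Fin m → ℝ)) (f : (Fin m → ℝ) → (Fin n → ℝ)) : Prop :=
  DefMapOn L m n X f ∧ CrMapOn r m n X f

/-- A definable `C^r` function `X → ℝ`. -/
def DefCrFunOn (r m : ℕ) (X : Set (Fin m → ℝ)) (f : (Fin m → ℝ) → ℝ) : Prop :=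
  DefFunOn L m X f ∧ CrFunOn r m X f

/-- A definable `C^r` submanifold of `ℝⁿ` of dimension `d`: around every point there is a
definable `C^r` chart of `ℝⁿ` straightening `M` to the first `d` coordinates. -/
def IsDefCrSubmanifold (r n d : ℕ) (M : Set (Fin n → ℝ)) : Prop :=
  Def L n M ∧
  ∀ a ∈ M, ∃ (U V : Set (Fin n → ℝ)) (φ ψ : (Fin n → ℝ) → (Fin n → ℝ)),
    a ∈ U ∧ IsOpen U ∧ Def L n U ∧
    (0 : Fin n → ℝ) ∈ V ∧ IsOpen V ∧ Def L n V ∧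
    DefMapOn L n n U φ ∧ DefMapOn L n n V ψ ∧
    ContDiffOn ℝ r φ U ∧ ContDiffOn ℝ r ψ V ∧
    Set.BijOn φ U V ∧ Set.InvOn ψ φ U V ∧
    φ a = 0 ∧
    φ '' (M ∩ U) = {x ∈ V | ∀ i : Fin n, d ≤ (i : ℕ) → x i = 0}

/-- The Euclidean norm on `ℝⁿ`. -/
noncomputable def eunorm {n : ℕ} (x : Fin n → ℝ) : ℝ := Real.sqrt (∑ i, x i ^ 2)

/-- Projection of `ℝⁿ` onto the `d` coordinates selected by `σ`. -/
def coordProj {n : ℕ} (d : ℕ) (σ : Fin d → Fin n) (x : Fin n → ℝ) : Fin d → ℝ :=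
  fun i => x (σ i)

/-- `X ⊆ ℝⁿ` has dimension `d`: `d` is the largest integer such that some coordinate
projection of `X` onto `ℝ^d` has nonempty interior. -/
def HasDim {n : ℕ} (X : Set (Fin n → ℝ)) (d : ℕ) : Prop :=
  (∃ σ : Fin d → Fin n, Function.Injective σ ∧ (interior (coordProj d σ '' X)).Nonempty) ∧
  ∀ (e : ℕ) (σ : Fin e → Fin n), Function.Injective σ →
    (interior (coordProj e σ '' X)).Nonempty → e ≤ d

/-- A (bounded) open box in `ℝⁿ`. -/
def IsOpenBox {n : ℕ} (B : Set (Fin n → ℝ)) : Prop :=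
  ∃ a b : Fin n → ℝ, (∀ i, a i < b i) ∧ B = Set.pi Set.univ fun i => Set.Ioo (a i) (b i)


/-- `DefFunOn` over the whole space is definability of functions in the sense of Mathlib. -/
theorem defFunOn_univ_iff {L : FirstOrder.Language} [L.Structure ℝ] {n : ℕ}
    {φ : (Fin n → ℝ) → ℝ} :
    DefFunOn L n Set.univ φ ↔ (Set.univ : Set ℝ).DefinableFun L φ := by
  constructor
  · intro h
    have := h.preimage_comp (Fin.addCases (fun i => some i) (fun _ => none) :
      Fin (n + 1) → Option (Fin n))
    refine (congrArg (Set.Definable Set.univ L) (Set.ext fun w => ?_)).mp this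
    simp [Function.tupleGraph, sndFun, funext_iff, Function.comp_def, eq_comm]
    unfold fstFun
    simp
  · intro h
    have := h.preimage_comp (fun o : Option (Fin n) =>
      o.elim (Fin.natAdd n (0 : Fin 1)) (Fin.castAdd 1))
    refine (congrArg (Set.Definable Set.univ L) (Set.ext fun w => ?_)).mp this
    simp [Function.tupleGraph, sndFun, funext_iff, Function.comp_def, eq_comm]
    rfl

section DefinableFunctions

variable {L : FirstOrder.Language} [L.Structure ℝ] {α : Type*} {φ ψ : (α → ℝ) → ℝ}

theorem definableFun_const (c : ℝ) : (Set.univ : Set ℝ).DefinableFun L fun _ : α → ℝ => c :=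
  L.definableFun_const α (Set.mem_univ c)

theorem definable_lt (h : ExpandsOrderedField L) (hφ : (Set.univ : Set ℝ).DefinableFun L φ)
    (hψ : (Set.univ : Set ℝ).DefinableFun L ψ) :
    (Set.univ : Set ℝ).Definable L {x | φ x < ψ x} := by
  have hF : (Set.univ : Set ℝ).DefinableMap L (fun x => ![φ x, ψ x]) := by
    intro i
    fin_cases i <;> simpa
  exact Definable.preimage_map hF h.1

theorem definableFun_max_zero (h : ExpandsOrderedField L)
    (hφ : (Set.univ : Set ℝ).DefinableFun L φ) :
    (Set.univ : Set ℝ).DefinableFun L fun x => max (φ x) 0 := by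
  classical
  have hite := DefinableFun.ite (definable_lt h (definableFun_const 0) hφ) hφ
    (definableFun_const 0)
  convert! hite using 2 with x
  split_ifs with hx
  · exact max_eq_left hx.le
  · exact max_eq_right (not_lt.mp hx)

variable [Finite α]

theorem definableFun_comp_some (hφ : (Set.univ : Set ℝ).DefinableFun L φ) :
    (Set.univ : Set ℝ).DefinableFun L fun w : Option α → ℝ => φ (w ∘ some) :=
  DefinableFun.comp (g := fun w : Option α → ℝ => w ∘ some)
    (fun i => DefinableFun.proj L (i := some i)) hφ

theorem definableFun_binary {op : ℝ → ℝ → ℝ} (hop : Def L 3 {x | op (x 0) (x 1) = x 2})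
    (hφ : (Set.univ : Set ℝ).DefinableFun L φ) (hψ : (Set.univ : Set ℝ).DefinableFun L ψ) :
    (Set.univ : Set ℝ).DefinableFun L fun x => op (φ x) (ψ x) := by
  have hF : (Set.univ : Set ℝ).DefinableMap L
      (fun w : Option α → ℝ => ![φ (w ∘ some), ψ (w ∘ some), w none]) := by
    intro i
    fin_cases i
    · exact definableFun_comp_some hφ
    · exact definableFun_comp_some hψ
    · exact DefinableFun.proj L
  exact Definable.preimage_map hF hop

theorem definableFun_add (h : ExpandsOrderedField L) (hφ : (Set.univ : Set ℝ).DefinableFun L φ)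
    (hψ : (Set.univ : Set ℝ).DefinableFun L ψ) :
    (Set.univ : Set ℝ).DefinableFun L fun x => φ x + ψ x :=
  definableFun_binary h.2.1 hφ hψ

theorem definableFun_mul (h : ExpandsOrderedField L) (hφ : (Set.univ : Set ℝ).DefinableFun L φ)
    (hψ : (Set.univ : Set ℝ).DefinableFun L ψ) :
    (Set.univ : Set ℝ).DefinableFun L fun x => φ x * ψ x :=
  definableFun_binary h.2.2.1 hφ hψ

theorem definableFun_neg (h : ExpandsOrderedField L)
    (hφ : (Set.univ : Set ℝ).DefinableFun L φ) :
    (Set.univ : Set ℝ).DefinableFun L fun x => -φ x := by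
  simpa using definableFun_mul h (definableFun_const (-1)) hφ

theorem definableFun_pow (h : ExpandsOrderedField L)
    (hφ : (Set.univ : Set ℝ).DefinableFun L φ) (m : ℕ) :
    (Set.univ : Set ℝ).DefinableFun L fun x => φ x ^ m := by
  induction m with
  | zero => simpa using definableFun_const 1
  | succ m ih => simpa only [pow_succ] using definableFun_mul h ih hφ

theorem definableFun_sum (h : ExpandsOrderedField L) {ι : Type*} (s : Finset ι)
    {Φ : ι → (α → ℝ) → ℝ} (hΦ : ∀ i, (Set.univ : Set ℝ).DefinableFun L (Φ i)) :
    (Set.univ : Set ℝ).DefinableFun L fun x => ∑ i ∈ s, Φ i x := by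
  classical
  induction s using Finset.induction_on with
  | empty => simpa using definableFun_const 0
  | insert i s hi ih =>
    simpa only [Finset.sum_insert hi] using definableFun_add h (hΦ i) ih

theorem definableFun_inv (h : ExpandsOrderedField L)
    (hφ : (Set.univ : Set ℝ).DefinableFun L φ) :
    (Set.univ : Set ℝ).DefinableFun L fun x => (φ x)⁻¹ := by
  have hs := definableFun_comp_some hφ
  have hn : (Set.univ : Set ℝ).DefinableFun L fun w : Option α → ℝ => w none :=
    DefinableFun.proj L
  have h0 := definableFun_const (L := L) (α := Option α) 0
  have key := ((definableFun_mul h hs hn).ofPred_eq (definableFun_const 1)).union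
    ((hs.ofPred_eq h0).inter (hn.ofPred_eq h0))
  refine (congrArg (Set.Definable Set.univ L) (Set.ext fun w => ?_)).mp key
  simp only [Function.tupleGraph, Set.mem_union, Set.mem_inter_iff, Set.mem_ofPred_eq]
  by_cases hw : φ (w ∘ some) = 0
  · simp [hw, eq_comm]
  · simp [hw, mul_eq_one_iff_inv_eq₀]

theorem definableFun_sqrt (h : ExpandsOrderedField L)
    (hφ : (Set.univ : Set ℝ).DefinableFun L φ) :
    (Set.univ : Set ℝ).DefinableFun L fun x => √(φ x) := by
  have hs := definableFun_comp_some hφ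
  have hn : (Set.univ : Set ℝ).DefinableFun L fun w : Option α → ℝ => w none :=
    DefinableFun.proj L
  have h0 := definableFun_const (L := L) (α := Option α) 0
  have key := ((definable_lt h hn h0).compl.inter
      ((definableFun_mul h hn hn).ofPred_eq hs)).union
    ((definable_lt h hs h0).inter (hn.ofPred_eq h0))
  refine (congrArg (Set.Definable Set.univ L) (Set.ext fun w => ?_)).mp key
  simp only [Function.tupleGraph, Set.mem_union, Set.mem_inter_iff, Set.mem_compl_iff,
    Set.mem_ofPred_eq, not_lt]
  rw [Real.sqrt_eq_cases, eq_comm (a := w none * w none)]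
  grind

end DefinableFunctions

theorem hasDerivAt_max_zero_pow (m : ℕ) (t : ℝ) :
    HasDerivAt (fun t : ℝ => max t 0 ^ (m + 2)) ((m + 2) * max t 0 ^ (m + 1)) t := by
  rcases lt_trichotomy t 0 with ht | rfl | ht
  · have hd : HasDerivAt (fun _ : ℝ => (0 : ℝ)) 0 t := hasDerivAt_const t 0
    rw [max_eq_right ht.le]
    simp only [ne_eq, Nat.add_eq_zero_iff, one_ne_zero, and_false, not_false_eq_true, zero_pow,
      mul_zero]
    refine hd.congr_of_eventuallyEq ?_
    filter_upwards [Iio_mem_nhds ht] with s hs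
    simp [max_eq_right (Set.mem_Iio.mp hs).le]
  · rw [hasDerivAt_iff_isLittleO]
    simp only [max_self, ne_eq, Nat.add_eq_zero_iff, one_ne_zero, OfNat.ofNat_ne_zero, and_false,
      not_false_eq_true, zero_pow, mul_zero, smul_zero, sub_zero]
    have hpow : (fun t : ℝ => t ^ (m + 2)) =o[𝓝 0] fun t : ℝ => t := by
      simpa using Asymptotics.isLittleO_pow_pow (𝕜 := ℝ) (show 1 < m + 2 by omega)
    refine (Asymptotics.isBigO_of_le _ fun t => ?_).trans_isLittleO hpow
    rw [norm_pow, norm_pow]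
    gcongr
    rcases le_total t 0 with ht | ht <;> simp [ht]
  · have hd := hasDerivAt_pow (m + 2) t
    rw [max_eq_left ht.le]
    refine (hd.congr_of_eventuallyEq ?_).congr_deriv (by push_cast; rfl)
    filter_upwards [Ioi_mem_nhds ht] with s hs
    rw [max_eq_left (Set.mem_Ioi.mp hs).le]

theorem contDiff_max_zero_pow (r : ℕ) : ContDiff ℝ r fun t : ℝ => max t 0 ^ (r + 1) := by
  induction r with
  | zero =>
    simp only [Nat.cast_zero, contDiff_zero]
    fun_prop
  | succ r ih =>
    have hd := hasDerivAt_max_zero_pow r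
    push_cast
    refine contDiff_succ_iff_deriv.mpr ⟨fun t => (hd t).differentiableAt, by simp, ?_⟩
    rw [show deriv (fun t : ℝ => max t 0 ^ (r + 1 + 1)) =
      fun t => ((r : ℝ) + 2) * max t 0 ^ (r + 1) from funext fun t => (hd t).deriv]
    exact contDiff_const.mul ih

/-- definable Positivstellensatz, part (ii). -/
theorem statement5
    (hfield : ExpandsOrderedField L) (hlom : LocallyOMinimal L)
    (r n k : ℕ) (f : Fin k → (Fin n → ℝ) → ℝ)
    (hfdef : ∀ i, DefFunOn L n Set.univ (f i)) (hfC : ∀ i, ContDiff ℝ r (f i))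
    (S : Set (Fin n → ℝ)) (hS : S = {x | ∀ i, 0 ≤ f i x}) (hSne : S.Nonempty)
    (g : (Fin n → ℝ) → ℝ) (hgdef : DefFunOn L n Set.univ g) (hgC : ContDiff ℝ r g)
    (hgS : ∀ x ∈ S, 0 < g x) :
    ∃ (v₀ : (Fin n → ℝ) → ℝ) (v : Fin k → (Fin n → ℝ) → ℝ),
      DefFunOn L n Set.univ v₀ ∧ ContDiff ℝ r v₀ ∧
      (∀ i, DefFunOn L n Set.univ (v i) ∧ ContDiff ℝ r (v i)) ∧
      ∀ x, g x = (v₀ x) ^ 2 + ∑ i, (v i x) ^ 2 * f i x := by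
  simp only [defFunOn_univ_iff] at hfdef hgdef ⊢
  let p : Fin k → (Fin n → ℝ) → ℝ := fun i x => max (-f i x) 0 ^ (r + 1)
  let F : (Fin n → ℝ) → ℝ := fun x => ∑ i, p i x ^ 2 * -f i x
  let D : (Fin n → ℝ) → ℝ := fun x => F x + max (g x) 0 ^ (r + 1)
  let H : (Fin n → ℝ) → ℝ := fun x => (1 + g x ^ 2) * (1 + F x) * (D x)⁻¹
  let T : (Fin n → ℝ) → ℝ := fun x => g x + H x ^ 2 * F x
  have term_nonneg (i : Fin k) (x : Fin n → ℝ) : 0 ≤ p i x ^ 2 * -f i x := by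
    rcases le_total 0 (f i x) with hx | hx
    · simp [p, hx]
    · exact mul_nonneg (sq_nonneg _) (neg_nonneg.mpr hx)
  have F_nonneg (x : Fin n → ℝ) : 0 ≤ F x := Finset.sum_nonneg fun i _ => term_nonneg i x
  have F_pos (x : Fin n → ℝ) (hx : x ∉ S) : 0 < F x := by
    obtain ⟨i, hi⟩ : ∃ i, f i x < 0 := by simpa [hS] using hx
    refine Finset.sum_pos' (fun i _ => term_nonneg i x) ⟨i, Finset.mem_univ i, ?_⟩
    have : 0 < max (-f i x) 0 := lt_max_of_lt_left (neg_pos.mpr hi)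
    have : 0 < -f i x := neg_pos.mpr hi
    positivity
  have D_pos (x : Fin n → ℝ) : 0 < D x := by
    by_cases hx : x ∈ S
    · have : 0 < max (g x) 0 := lt_max_of_lt_left (hgS x hx)
      exact add_pos_of_nonneg_of_pos (F_nonneg x) (by positivity)
    · exact add_pos_of_pos_of_nonneg (F_pos x hx) (by positivity)
  have T_pos (x : Fin n → ℝ) : 0 < T x := by
    rcases lt_or_ge 0 (g x) with hg | hg
    · exact add_pos_of_pos_of_nonneg hg (mul_nonneg (sq_nonneg _) (F_nonneg x))
    · have hF : 0 < F x := F_pos x fun hx => (hgS x hx).not_ge hg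
      have hD : D x = F x := by simp [D, hg]
      have hH : H x ^ 2 * F x = (1 + g x ^ 2) ^ 2 * ((1 + F x) ^ 2 / F x) := by
        simp only [H, hD]
        field_simp
      have hle : 1 ≤ (1 + F x) ^ 2 / F x := by
        rw [le_div_iff₀ hF]
        nlinarith
      have : (1 + g x ^ 2) ^ 2 ≤ H x ^ 2 * F x := by
        rw [hH]
        exact le_mul_of_one_le_right (sq_nonneg _) hle
      change 0 < g x + H x ^ 2 * F x
      nlinarith [sq_nonneg (g x), sq_nonneg (g x + 1), sq_nonneg (g x ^ 2)]
  have pC (i : Fin k) : ContDiff ℝ r (p i) := (contDiff_max_zero_pow r).comp (hfC i).neg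
  have FC : ContDiff ℝ r F := ContDiff.sum fun i _ => ((pC i).pow 2).mul (hfC i).neg
  have DC : ContDiff ℝ r D := FC.add ((contDiff_max_zero_pow r).comp hgC)
  have HC : ContDiff ℝ r H :=
    ((contDiff_const.add (hgC.pow 2)).mul (contDiff_const.add FC)).mul
      (DC.inv fun x => (D_pos x).ne')
  have TC : ContDiff ℝ r T := hgC.add ((HC.pow 2).mul FC)
  have pD (i : Fin k) : (Set.univ : Set ℝ).DefinableFun L (p i) :=
    definableFun_pow hfield (definableFun_max_zero hfield (definableFun_neg hfield (hfdef i))) _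
  have FD : (Set.univ : Set ℝ).DefinableFun L F :=
    definableFun_sum hfield _ fun i => definableFun_mul hfield (definableFun_pow hfield (pD i) 2)
      (definableFun_neg hfield (hfdef i))
  have DD : (Set.univ : Set ℝ).DefinableFun L D :=
    definableFun_add hfield FD (definableFun_pow hfield (definableFun_max_zero hfield hgdef) _)
  have HD : (Set.univ : Set ℝ).DefinableFun L H :=
    definableFun_mul hfield
      (definableFun_mul hfield
        (definableFun_add hfield (definableFun_const 1) (definableFun_pow hfield hgdef 2))
        (definableFun_add hfield (definableFun_const 1) FD))
      (definableFun_inv hfield DD)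
  have TD : (Set.univ : Set ℝ).DefinableFun L T :=
    definableFun_add hfield hgdef (definableFun_mul hfield (definableFun_pow hfield HD 2) FD)
  refine ⟨fun x => √(T x), fun i x => H x * p i x, definableFun_sqrt hfield TD,
    TC.sqrt fun x => (T_pos x).ne', fun i => ⟨definableFun_mul hfield HD (pD i), HC.mul (pC i)⟩,
    fun x => ?_⟩
  have hsum : ∑ i, (H x * p i x) ^ 2 * f i x = -(H x ^ 2 * F x) := by
    simp only [F, Finset.mul_sum, ← Finset.sum_neg_distrib]
    exact Finset.sum_congr rfl fun i _ => by ring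
  rw [Real.sq_sqrt (T_pos x).le, hsum]
  ring

end Paper
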